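/- arXiv:2510.07788 — 2 statements merged into one kernel-verified Lean document; each statement's English description precedes it below -/
import Mathlib

section
/- Diagonal Expression Lemma for the debiased Keyl (box-donation) estimator: let λ be a Young diagram with at most d rows, let i, j ∈ [d], and assume λ + e_i is again a Young diagram, i.e. i = 1 or λ_{i−1} > λ_i. Then ∑_{k=1}^{d} ∑_{ℓ=1}^{d} (λ↑_k · λ↑_ℓ + (1/Δ) · λ↑_{max(k,ℓ)}) · g(k, ℓ) = (C_i + 1)(C^{λ+e_i}_j + 1) · D_{d→ij}. -/
open Finset

/-- The Weyl dimension polynomial `WD_p(mu) = prod_{1 <= a < b <= p} ((mu_a - mu_b) + (b - a))/(b - a)`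
of the integer tuple `(mu 1, ..., mu p)`. -/
def weylDim (p : ℕ) (μ : ℕ → ℤ) : ℚ :=
  ∏ a ∈ Finset.Icc 1 p, ∏ b ∈ Finset.Icc (a + 1) p,
    (((μ a : ℚ) - (μ b : ℚ)) + ((b : ℚ) - (a : ℚ))) / ((b : ℚ) - (a : ℚ))

/-- `addBox μ y = μ + e_y`: the tuple `μ` with `1` added in coordinate `y`. -/
def addBox (μ : ℕ → ℤ) (y : ℕ) : ℕ → ℤ := fun x => μ x + if x = y then 1 else 0

/-- The dimension ratio `D^μ_{k→y} = WD_k(μ + e_y)/WD_k(μ)` for `y ≤ k`, and `0` for `k < y`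
(division by zero evaluates to `0`). -/
def dimRatio (μ : ℕ → ℤ) (k y : ℕ) : ℚ :=
  if y ≤ k then weylDim k (addBox μ y) / weylDim k μ else 0

def intOf (lam : ℕ → ℕ) : ℕ → ℤ := fun x => (lam x : ℤ)

/-- `Δ = (λ_j − λ_i) + (i − j) + δ_{ij}`. -/
def Del (lam : ℕ → ℕ) (i j : ℕ) : ℚ :=
  (((lam j : ℚ) - (lam i : ℚ)) + ((i : ℚ) - (j : ℚ))) + (if i = j then 1 else 0)

/-- The partial-sum function `F(s, t)` of squared two-step Clebsch–Gordan coefficients. -/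
def Fcoef (lam : ℕ → ℕ) (i j : ℕ) (s t : ℕ) : ℚ :=
  if s ≤ t then dimRatio (intOf lam) s i * dimRatio (addBox (intOf lam) i) t j
  else
    dimRatio (intOf lam) t j * dimRatio (addBox (intOf lam) j) s i
      + 1 / Del lam i j ^ 2 *
          (dimRatio (intOf lam) t i * dimRatio (addBox (intOf lam) i) s j
            - dimRatio (intOf lam) t j * dimRatio (addBox (intOf lam) j) s i)

/-- The squared two-step Clebsch–Gordan coefficient `g(k, ℓ)`. -/
def gcoef (lam : ℕ → ℕ) (i j : ℕ) (k l : ℕ) : ℚ :=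
  Fcoef lam i j k l - Fcoef lam i j (k - 1) l - Fcoef lam i j k (l - 1)
    + Fcoef lam i j (k - 1) (l - 1)

/-- `D_{s→ij}`. -/
def dimR2 (lam : ℕ → ℕ) (i j s : ℕ) : ℚ :=
  if max i j ≤ s then weylDim s (addBox (addBox (intOf lam) i) j) / weylDim s (intOf lam)
  else 0

/-- `C^{λ+e_i}_j = λ_j + δ_{ij} − j`. -/
def rowContentAdd (lam : ℕ → ℕ) (i j : ℕ) : ℚ :=
  ((lam j : ℚ) + (if i = j then 1 else 0)) - (j : ℚ)

/-- The content `C_x = λ_x − x` of row `x`. -/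
def rowContent (lam : ℕ → ℕ) (x : ℕ) : ℚ := (lam x : ℚ) - (x : ℚ)

/-- The box-donation transformation `λ↑`. -/
def donate (d : ℕ) (lam : ℕ → ℕ) (k : ℕ) : ℤ :=
  (lam k : ℤ)
    - (((Finset.Icc 1 d).filter fun j => j < k ∧ lam k < lam j).card : ℤ)
    + (((Finset.Icc 1 d).filter fun j => k < j ∧ lam j < lam k).card : ℤ)

/-- The function interpolating `D s * E t` (for `s ≤ t`) and its `e`-twisted version (for `t < s`). -/
def twoStep (e : ℚ) (D E : ℕ → ℚ) (s t : ℕ) : ℚ :=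
  if s ≤ t then D s * E t else (1 - e ^ 2) * (D s * E t) + e ^ 2 * (D t * E s)

/-- The mixed backward difference of a function of two natural numbers. -/
def mixedDiff (G : ℕ → ℕ → ℚ) (k l : ℕ) : ℚ :=
  G k l - G (k - 1) l - G k (l - 1) + G (k - 1) (l - 1)

theorem sum_Ioc_backward_diff (f : ℕ → ℚ) {q n : ℕ} (h : q ≤ n) :
    ∑ k ∈ Ioc q n, (f k - f (k - 1)) = f n - f q := by
  induction n, h using Nat.le_induction with
  | base => simp
  | succ n hn ih =>
    rw [Finset.sum_Ioc_succ_top (by omega), ih]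
    simp

theorem sum_mixedDiff_right (G : ℕ → ℕ → ℚ) (k : ℕ) {q n : ℕ} (h : q ≤ n) :
    ∑ l ∈ Ioc q n, mixedDiff G k l = (G k n - G (k - 1) n) - (G k q - G (k - 1) q) := by
  rw [← sum_Ioc_backward_diff (fun l => G k l - G (k - 1) l) h]
  refine Finset.sum_congr rfl fun l _ => ?_
  simp only [mixedDiff]; ring

theorem sum_mixedDiff_left (G : ℕ → ℕ → ℚ) (l : ℕ) {q n : ℕ} (h : q ≤ n) :
    ∑ k ∈ Ioc q n, mixedDiff G k l = (G n l - G n (l - 1)) - (G q l - G q (l - 1)) := by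
  rw [← sum_Ioc_backward_diff (fun k => G k l - G k (l - 1)) h]
  refine Finset.sum_congr rfl fun k _ => ?_
  simp only [mixedDiff]; ring

theorem twoStep_of_le (e : ℚ) (D E : ℕ → ℚ) {s t : ℕ} (h : s ≤ t) :
    twoStep e D E s t = D s * E t := if_pos h

theorem twoStep_of_ge (e : ℚ) (D E : ℕ → ℚ) {s t : ℕ} (h : t ≤ s) :
    twoStep e D E s t = (1 - e ^ 2) * (D s * E t) + e ^ 2 * (D t * E s) := by
  unfold twoStep
  split_ifs with h'
  · obtain rfl : s = t := le_antisymm h' h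
    ring
  · rfl

theorem sum_mul_backward_diff_extend (f w w' : ℕ → ℚ) (m V : ℚ) {q n : ℕ} (hqn : q ≤ n)
    (hw : ∀ k ∈ Ioc 0 q, w' k = w k + m) (hw' : ∀ k ∈ Ioc q n, w' k = V) :
    ∑ k ∈ Ioc 0 n, w' k * (f k - f (k - 1))
      = ∑ k ∈ Ioc 0 q, w k * (f k - f (k - 1)) + m * (f q - f 0) + V * (f n - f q) := by
  rw [← Finset.sum_Ioc_consecutive _ (Nat.zero_le q) hqn,
    ← sum_Ioc_backward_diff f hqn, ← sum_Ioc_backward_diff f (Nat.zero_le q),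
    Finset.mul_sum, Finset.mul_sum, ← Finset.sum_add_distrib]
  congr 1
  · refine Finset.sum_congr rfl fun k hk => ?_
    rw [hw k hk]; ring
  · refine Finset.sum_congr rfl fun k hk => ?_
    rw [hw' k hk]

/-- The weighted double sum of the mixed differences of `twoStep`. -/
def quadSum (e : ℚ) (D E w : ℕ → ℚ) (n : ℕ) : ℚ :=
  ∑ k ∈ Ioc 0 n, ∑ l ∈ Ioc 0 n, (w k * w l + e * w (max k l)) * mixedDiff (twoStep e D E) k l

theorem quadSum_extend (e : ℚ) (D E w w' : ℕ → ℚ) (m V : ℚ) {q n : ℕ} (hqn : q ≤ n)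
    (hD : D 0 = 0) (hE : (1 - e ^ 2) * E 0 = 0)
    (hw : ∀ k ∈ Ioc 0 q, w' k = w k + m) (hw' : ∀ k ∈ Ioc q n, w' k = V) {A B : ℚ}
    (hA : ∑ k ∈ Ioc 0 q, w k * (D k - D (k - 1)) = A)
    (hB : (1 - e ^ 2) * ∑ k ∈ Ioc 0 q, w k * (E k - E (k - 1)) = B) :
    quadSum e D E w' n = quadSum e D E w q
      + m * (A * E q + B * D q + e ^ 2 * (A * E q)) + (m ^ 2 + e * m) * (D q * E q)
      + V * ((A + (m + e) * D q) * (E n - E q))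
      + V * ((D n - D q) * (B + (m + e) * ((1 - e ^ 2) * E q))
          + e ^ 2 * ((E n - E q) * (A + (m + e) * D q)))
      + (V ^ 2 + e * V) * (D n * E n - D q * E n
          - ((1 - e ^ 2) * (D n * E q) + e ^ 2 * (D q * E n)) + D q * E q) := by
  set g := mixedDiff (twoStep e D E) with hg
  have hcol0 : ∀ s, twoStep e D E s 0 = 0 := fun s => by
    rw [twoStep_of_ge _ _ _ (Nat.zero_le s), hD]
    linear_combination D s * hE
  have hrow0 : ∀ t, twoStep e D E 0 t = 0 := fun t => by
    rw [twoStep_of_le _ _ _ (Nat.zero_le t), hD, zero_mul]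
  have hr : ∀ k ∈ Ioc 0 q, ∑ l ∈ Ioc 0 q, g k l = (D k - D (k - 1)) * E q := fun k hk => by
    obtain ⟨h1, h2⟩ := Finset.mem_Ioc.1 hk
    rw [hg, sum_mixedDiff_right _ _ (Nat.zero_le q), hcol0, hcol0,
      twoStep_of_le _ _ _ h2, twoStep_of_le _ _ _ (by omega : k - 1 ≤ q)]
    ring
  have hr' : ∀ k ∈ Ioc 0 q, ∑ l ∈ Ioc q n, g k l = (D k - D (k - 1)) * (E n - E q) :=
    fun k hk => by
    obtain ⟨h1, h2⟩ := Finset.mem_Ioc.1 hk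
    rw [hg, sum_mixedDiff_right _ _ hqn,
      twoStep_of_le _ _ _ h2, twoStep_of_le _ _ _ (by omega : k - 1 ≤ q),
      twoStep_of_le _ _ _ (by omega : k ≤ n), twoStep_of_le _ _ _ (by omega : k - 1 ≤ n)]
    ring
  have hc : ∀ l ∈ Ioc 0 q, ∑ k ∈ Ioc 0 q, g k l
      = (1 - e ^ 2) * D q * (E l - E (l - 1)) + e ^ 2 * E q * (D l - D (l - 1)) := fun l hl => by
    obtain ⟨h1, h2⟩ := Finset.mem_Ioc.1 hl
    rw [hg, sum_mixedDiff_left _ _ (Nat.zero_le q), hrow0, hrow0,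
      twoStep_of_ge _ _ _ h2, twoStep_of_ge _ _ _ (by omega : l - 1 ≤ q)]
    ring
  have hc' : ∀ l ∈ Ioc 0 q, ∑ k ∈ Ioc q n, g k l
      = (1 - e ^ 2) * (D n - D q) * (E l - E (l - 1))
        + e ^ 2 * (E n - E q) * (D l - D (l - 1)) := fun l hl => by
    obtain ⟨h1, h2⟩ := Finset.mem_Ioc.1 hl
    rw [hg, sum_mixedDiff_left _ _ hqn,
      twoStep_of_ge _ _ _ h2, twoStep_of_ge _ _ _ (by omega : l - 1 ≤ q),
      twoStep_of_ge _ _ _ (by omega : l ≤ n), twoStep_of_ge _ _ _ (by omega : l - 1 ≤ n)]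
    ring
  have hDs := sum_Ioc_backward_diff D (Nat.zero_le q)
  have hEs := sum_Ioc_backward_diff E (Nat.zero_le q)
  have h11 : ∑ k ∈ Ioc 0 q, ∑ l ∈ Ioc 0 q, (w' k * w' l + e * w' (max k l)) * g k l
      = quadSum e D E w q + m * (A * E q + B * D q + e ^ 2 * (A * E q))
        + (m ^ 2 + e * m) * (D q * E q) := by
    have h1 : ∑ k ∈ Ioc 0 q, ∑ l ∈ Ioc 0 q, (w' k * w' l + e * w' (max k l)) * g k l
        = quadSum e D E w q + m * ∑ k ∈ Ioc 0 q, w k * ∑ l ∈ Ioc 0 q, g k l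
          + m * ∑ l ∈ Ioc 0 q, w l * ∑ k ∈ Ioc 0 q, g k l
          + (m ^ 2 + e * m) * ∑ k ∈ Ioc 0 q, ∑ l ∈ Ioc 0 q, g k l := by
      have hsw : ∑ l ∈ Ioc 0 q, w l * ∑ k ∈ Ioc 0 q, g k l
          = ∑ k ∈ Ioc 0 q, ∑ l ∈ Ioc 0 q, w l * g k l := by
        rw [Finset.sum_comm]
        simp only [Finset.mul_sum]
      rw [hsw, quadSum]
      simp only [Finset.mul_sum, ← Finset.sum_add_distrib]
      refine Finset.sum_congr rfl fun k hk => Finset.sum_congr rfl fun l hl => ?_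
      have hmax : max k l ∈ Ioc 0 q := by
        rcases max_choice k l with h | h <;> rwa [h]
      rw [hw k hk, hw l hl, hw _ hmax]
      ring
    rw [h1, Finset.sum_congr rfl fun k hk => by rw [hr k hk],
      Finset.sum_congr (s₁ := Ioc 0 q) (f := fun l => w l * ∑ k ∈ Ioc 0 q, g k l) rfl
        fun l hl => by rw [hc l hl],
      Finset.sum_congr (f := fun k => ∑ l ∈ Ioc 0 q, g k l) rfl hr, ← Finset.sum_mul, hDs, hD]
    have h2 : ∑ k ∈ Ioc 0 q, w k * ((D k - D (k - 1)) * E q) = A * E q := by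
      rw [← hA, Finset.sum_mul]
      exact Finset.sum_congr rfl fun k _ => by ring
    have h3 : ∑ l ∈ Ioc 0 q, w l * ((1 - e ^ 2) * D q * (E l - E (l - 1))
        + e ^ 2 * E q * (D l - D (l - 1))) = B * D q + e ^ 2 * (A * E q) := by
      rw [← hA, ← hB]
      simp only [Finset.sum_mul, Finset.mul_sum, ← Finset.sum_add_distrib]
      exact Finset.sum_congr rfl fun k _ => by ring
    rw [h2, h3]
    ring
  have h12 : ∑ k ∈ Ioc 0 q, ∑ l ∈ Ioc q n, (w' k * w' l + e * w' (max k l)) * g k l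
      = V * ((A + (m + e) * D q) * (E n - E q)) := by
    have h1 : ∀ k ∈ Ioc 0 q, ∑ l ∈ Ioc q n, (w' k * w' l + e * w' (max k l)) * g k l
        = V * (E n - E q) * (w k * (D k - D (k - 1)))
          + V * (E n - E q) * (m + e) * (D k - D (k - 1)) := fun k hk => by
      have : ∀ l ∈ Ioc q n, (w' k * w' l + e * w' (max k l)) * g k l
          = ((w k + m) * V + e * V) * g k l := fun l hl => by
        have hkl : max k l = l := by
          simp only [Finset.mem_Ioc] at hk hl; omega
        rw [hkl, hw k hk, hw' l hl]
      rw [Finset.sum_congr rfl this, ← Finset.mul_sum, hr' k hk]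
      ring
    rw [Finset.sum_congr rfl h1, Finset.sum_add_distrib, ← Finset.mul_sum, ← Finset.mul_sum,
      hA, hDs, hD]
    ring
  have h21 : ∑ k ∈ Ioc q n, ∑ l ∈ Ioc 0 q, (w' k * w' l + e * w' (max k l)) * g k l
      = V * ((D n - D q) * (B + (m + e) * ((1 - e ^ 2) * E q))
          + e ^ 2 * ((E n - E q) * (A + (m + e) * D q))) := by
    rw [Finset.sum_comm]
    have h1 : ∀ l ∈ Ioc 0 q, ∑ k ∈ Ioc q n, (w' k * w' l + e * w' (max k l)) * g k l
        = V * (D n - D q) * ((1 - e ^ 2) * (w l * (E l - E (l - 1))))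
          + V * (D n - D q) * (m + e) * (1 - e ^ 2) * (E l - E (l - 1))
          + e ^ 2 * V * (E n - E q) * (w l * (D l - D (l - 1)))
          + e ^ 2 * V * (E n - E q) * (m + e) * (D l - D (l - 1)) := fun l hl => by
      have : ∀ k ∈ Ioc q n, (w' k * w' l + e * w' (max k l)) * g k l
          = (V * (w l + m) + e * V) * g k l := fun k hk => by
        have hkl : max k l = k := by
          simp only [Finset.mem_Ioc] at hk hl; omega
        rw [hkl, hw l hl, hw' k hk]
      rw [Finset.sum_congr rfl this, ← Finset.mul_sum, hc' l hl]
      ring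
    rw [Finset.sum_congr rfl h1, Finset.sum_add_distrib, Finset.sum_add_distrib,
      Finset.sum_add_distrib, ← Finset.mul_sum, ← Finset.mul_sum, ← Finset.mul_sum,
      ← Finset.mul_sum, ← Finset.mul_sum, hA, hB, hDs, hEs, hD]
    linear_combination -(V * (D n - D q) * (m + e)) * hE
  have h22 : ∑ k ∈ Ioc q n, ∑ l ∈ Ioc q n, (w' k * w' l + e * w' (max k l)) * g k l
      = (V ^ 2 + e * V) * (D n * E n - D q * E n
          - ((1 - e ^ 2) * (D n * E q) + e ^ 2 * (D q * E n)) + D q * E q) := by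
    have h1 : ∀ k ∈ Ioc q n, ∑ l ∈ Ioc q n, (w' k * w' l + e * w' (max k l)) * g k l
        = (V ^ 2 + e * V) * ((twoStep e D E k n - twoStep e D E k q)
          - (twoStep e D E (k - 1) n - twoStep e D E (k - 1) q)) := fun k hk => by
      have : ∀ l ∈ Ioc q n, (w' k * w' l + e * w' (max k l)) * g k l
          = (V ^ 2 + e * V) * g k l := fun l hl => by
        have hmax : max k l ∈ Ioc q n := by
          rcases max_choice k l with h | h <;> rwa [h]
        rw [hw' k hk, hw' l hl, hw' _ hmax]
        ring
      rw [Finset.sum_congr rfl this, ← Finset.mul_sum, hg, sum_mixedDiff_right _ _ hqn]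
      ring
    rw [Finset.sum_congr rfl h1, ← Finset.mul_sum,
      sum_Ioc_backward_diff (fun k => twoStep e D E k n - twoStep e D E k q) hqn,
      twoStep_of_le _ _ _ le_rfl, twoStep_of_ge _ _ _ hqn, twoStep_of_le _ _ _ hqn,
      twoStep_of_le _ _ _ le_rfl]
    ring
  rw [quadSum, ← Finset.sum_Ioc_consecutive _ (Nat.zero_le q) hqn]
  simp only [← Finset.sum_Ioc_consecutive _ (Nat.zero_le q) hqn, Finset.sum_add_distrib]
  rw [← hg, h11, h12, h21, h22]
  ring

/-- Evaluation of `quadSum` when the weights for `n` rows are those for some `q < n` rows shifted by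
`n - q`, and are constant on the remaining rows. -/
theorem quadSum_eq (e X Y : ℚ) (he : e * (Y - X) = 1) (D E : ℕ → ℚ) (w : ℕ → ℕ → ℚ) (d : ℕ)
    (hD : D 0 = 0) (hE : (1 - e ^ 2) * E 0 = 0)
    (hblock : ∀ n, 1 ≤ n → n ≤ d → ∃ q < n, ∃ V : ℚ,
      (∀ k ∈ Ioc 0 q, w n k = w q k + ((n : ℚ) - q)) ∧ (∀ k ∈ Ioc q n, w n k = V) ∧
      (X - V) * (D n - D q) = ((n : ℚ) - q) * D q ∧
      (1 - e ^ 2) * ((Y - V) * (E n - E q)) = (1 - e ^ 2) * (((n : ℚ) - q) * E q) ∧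
      ((D n = 0 ∧ D q = 0) ∨ (Y - V) * (E n - E q) = ((n : ℚ) - q) * E q))
    (n : ℕ) (hn : n ≤ d) :
    quadSum e D E (w n) n = X * Y * (D n * E n) ∧
      ∑ k ∈ Ioc 0 n, w n k * (D k - D (k - 1)) = X * D n ∧
      (1 - e ^ 2) * ∑ k ∈ Ioc 0 n, w n k * (E k - E (k - 1)) = (1 - e ^ 2) * (Y * E n) := by
  induction n using Nat.strong_induction_on with
  | _ n ih =>
  rcases Nat.eq_zero_or_pos n with rfl | hpos
  · refine ⟨by simp [quadSum, hD], by simp [hD], ?_⟩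
    simp only [Finset.Ioc_self, Finset.sum_empty]
    linear_combination -Y * hE
  obtain ⟨q, hq, V, hw, hw', hrD, hrE, hrDE⟩ := hblock n hpos hn
  obtain ⟨ihQ, ihD, ihE⟩ := ih q hq (by omega)
  have hm : (n : ℚ) - q ≠ 0 := sub_ne_zero.2 (by exact_mod_cast hq.ne')
  rw [sum_mul_backward_diff_extend D _ _ _ _ hq.le hw hw', ihD,
    sum_mul_backward_diff_extend E _ _ _ _ hq.le hw hw',
    quadSum_extend e D E _ _ _ _ hq.le hD hE hw hw' ihD ihE, ihQ]
  refine ⟨?_, ?_, ?_⟩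
  · rcases hrDE with ⟨h1, h2⟩ | hrE'
    · rw [h1, h2]; ring
    · generalize (n : ℚ) - q = m at *
      obtain ⟨a, ha⟩ : ∃ a, D n = D q + m * a := ⟨(D n - D q) / m, by field_simp; ring⟩
      obtain ⟨b, hb⟩ : ∃ b, E n = E q + m * b := ⟨(E n - E q) / m, by field_simp; ring⟩
      have hDq : D q = (X - V) * a := by
        apply mul_left_cancel₀ hm; rw [ha] at hrD; linear_combination -hrD
      have hEq : E q = (Y - V) * b := by
        apply mul_left_cancel₀ hm; rw [hb] at hrE'; linear_combination -hrE'
      have hY : Y = X + 1 / e := by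
        have : e ≠ 0 := by rintro rfl; simp at he
        field_simp; linear_combination he
      have he0 : e ≠ 0 := by rintro rfl; simp at he
      rw [ha, hb, hDq, hEq, hY]
      field_simp
      ring
  · rw [hD]; linear_combination -hrD
  · linear_combination ihE - hrE - ((n : ℚ) - q) * hE

theorem exists_last_block (lam : ℕ → ℕ) (n : ℕ) (hn : 1 ≤ n)
    (hlam : ∀ a b, 1 ≤ a → a ≤ b → b ≤ n → lam b ≤ lam a) :
    ∃ q < n, (∀ k ∈ Ioc 0 q, lam n < lam k) ∧ ∀ k ∈ Ioc q n, lam k = lam n := by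
  classical
  have hex : ∃ q, lam (q + 1) = lam n := ⟨n - 1, by rw [Nat.sub_add_cancel hn]⟩
  have hle : Nat.find hex ≤ n - 1 := Nat.find_min' hex (by rw [Nat.sub_add_cancel hn])
  refine ⟨Nat.find hex, by omega, fun k hk => ?_, fun k hk => ?_⟩
  · obtain ⟨h1, h2⟩ := Finset.mem_Ioc.1 hk
    have h3 := Nat.find_min hex (m := k - 1) (by omega)
    rw [Nat.sub_add_cancel h1] at h3
    exact lt_of_le_of_ne (hlam k n h1 (by omega) le_rfl) (Ne.symm h3)
  · obtain ⟨h1, h2⟩ := Finset.mem_Ioc.1 hk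
    have h3 := Nat.find_spec hex
    have h4 := hlam (Nat.find hex + 1) k (by omega) (by omega) h2
    have h5 := hlam k n (by omega) h2 le_rfl
    omega

theorem donate_of_le (lam : ℕ → ℕ) {q n k : ℕ} (hqn : q ≤ n) (hk : k ∈ Ioc 0 q)
    (hlt : ∀ k ∈ Ioc 0 q, lam n < lam k) (heq : ∀ k ∈ Ioc q n, lam k = lam n) :
    donate n lam k = donate q lam k + ((n : ℤ) - q) := by
  obtain ⟨hk0, hkq⟩ := Finset.mem_Ioc.1 hk
  have h1 : ((Finset.Icc 1 n).filter fun j => j < k ∧ lam k < lam j)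
      = (Finset.Icc 1 q).filter fun j => j < k ∧ lam k < lam j := by
    ext j; simp only [Finset.mem_filter, Finset.mem_Icc]; omega
  have h2 : ((Finset.Icc 1 n).filter fun j => k < j ∧ lam j < lam k)
      = ((Finset.Icc 1 q).filter fun j => k < j ∧ lam j < lam k) ∪ Ioc q n := by
    ext j
    simp only [Finset.mem_filter, Finset.mem_Icc, Finset.mem_union, Finset.mem_Ioc]
    constructor
    · rintro ⟨⟨h1, h2⟩, h3, h4⟩; omega
    · rintro (h | h)
      · omega
      · have := hlt k hk
        have := heq j (Finset.mem_Ioc.2 h)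
        omega
  have h3 : Disjoint ((Finset.Icc 1 q).filter fun j => k < j ∧ lam j < lam k) (Ioc q n) := by
    rw [Finset.disjoint_left]
    intro j
    simp only [Finset.mem_filter, Finset.mem_Icc, Finset.mem_Ioc]
    omega
  rw [donate, donate, h1, h2, Finset.card_union_of_disjoint h3, Nat.card_Ioc]
  push_cast [hqn]
  ring

theorem donate_last_block (lam : ℕ → ℕ) {q n k : ℕ} (hk : k ∈ Ioc q n)
    (hlt : ∀ k ∈ Ioc 0 q, lam n < lam k) (heq : ∀ k ∈ Ioc q n, lam k = lam n) :
    donate n lam k = (lam n : ℤ) - q := by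
  obtain ⟨hk0, hkq⟩ := Finset.mem_Ioc.1 hk
  have hkn := heq k hk
  have hcase : ∀ j, 1 ≤ j → j ≤ n → (j ≤ q ∧ lam n < lam j) ∨ (q < j ∧ lam j = lam n) := by
    intro j h1 h2
    rcases le_or_gt j q with h | h
    · exact Or.inl ⟨h, hlt j (Finset.mem_Ioc.2 ⟨h1, h⟩)⟩
    · exact Or.inr ⟨h, heq j (Finset.mem_Ioc.2 ⟨h, h2⟩)⟩
  have h1 : ((Finset.Icc 1 n).filter fun j => j < k ∧ lam k < lam j) = Finset.Icc 1 q := by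
    ext j; simp only [Finset.mem_filter, Finset.mem_Icc]
    constructor
    · rintro ⟨⟨h1, h2⟩, h3, h4⟩
      have := hcase j h1 h2
      omega
    · rintro ⟨h1, h2⟩
      have := hcase j h1 (by omega)
      omega
  have h2 : ((Finset.Icc 1 n).filter fun j => k < j ∧ lam j < lam k) = ∅ := by
    ext j
    simp only [Finset.mem_filter, Finset.mem_Icc, Finset.notMem_empty, iff_false]
    rintro ⟨⟨h1, h2⟩, h3, h4⟩
    have := hcase j h1 h2
    omega
  rw [donate, h1, h2, hkn]
  simp

theorem block_relation (D : ℕ → ℚ) (z : ℚ) {q n : ℕ} (hqn : q < n)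
    (hfirst : z * (D (q + 1) - D q) = D q)
    (hconst : ∀ k, q + 1 < k → k ≤ n → D k - D (k - 1) = D (k - 1) - D (k - 2)) :
    z * (D n - D q) = ((n : ℚ) - q) * D q := by
  have hstep : ∀ k, q + 1 ≤ k → k ≤ n → D k - D (k - 1) = D (q + 1) - D q := by
    intro k hk
    induction k, hk using Nat.le_induction with
    | base => intro _; simp
    | succ k hk ih =>
      intro hkn
      rw [hconst (k + 1) (by omega) hkn, ← ih (by omega)]
      rfl
  have hsum := sum_Ioc_backward_diff D hqn.le
  rw [Finset.sum_congr rfl fun k hk => hstep k (Finset.mem_Ioc.1 hk).1 (Finset.mem_Ioc.1 hk).2,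
    Finset.sum_const, Nat.card_Ioc, nsmul_eq_mul, Nat.cast_sub hqn.le] at hsum
  rw [← hsum]
  linear_combination ((n : ℚ) - q) * hfirst

theorem const_diff_of_rec (D C : ℕ → ℚ) (c : ℚ) (k : ℕ) (hC : C (k - 1) = C k + 1)
    (hk : (c - C k) * (D k - D (k - 1)) = D (k - 1))
    (hk' : (c - C (k - 1)) * (D (k - 1) - D (k - 2)) = D (k - 2)) (hne : c - C k ≠ 0) :
    D k - D (k - 1) = D (k - 1) - D (k - 2) := by
  apply mul_left_cancel₀ hne
  rw [hC] at hk'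
  linear_combination hk - hk'

/-- The sum with box-donation weights, for any `D` and `E` which satisfy the recurrences of the
one-step dimension ratios with contents `c` and `c'`. -/
theorem quadSum_donate (e c c' : ℚ) (he : e * (c' - c) = 1) (D E : ℕ → ℚ) (lam : ℕ → ℕ) (d i : ℕ)
    (hlam : ∀ a b, 1 ≤ a → a ≤ b → b ≤ d → lam b ≤ lam a)
    (hi : 1 ≤ i) (hvalid : i = 1 ∨ lam i < lam (i - 1))
    (hDi : ∀ k < i, D k = 0) (hE : (1 - e ^ 2) * E 0 = 0)
    (hDrec : ∀ k, 1 ≤ k → k ≤ d → (c - rowContent lam k) * (D k - D (k - 1)) = D (k - 1))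
    (hDconst : ∀ k, 2 ≤ k → k ≤ d → lam k = lam (k - 1) →
      D k - D (k - 1) = D (k - 1) - D (k - 2))
    (hErec : ∀ k, 1 ≤ k → k ≤ d → (i ≤ k ∨ 1 - e ^ 2 ≠ 0) →
      (c' - rowContent lam k) * (E k - E (k - 1)) = E (k - 1))
    (hEconst : ∀ k, 2 ≤ k → k ≤ d → lam k = lam (k - 1) → (i < k ∨ 1 - e ^ 2 ≠ 0) →
      E k - E (k - 1) = E (k - 1) - E (k - 2)) :
    quadSum e D E (fun k => (donate d lam k : ℚ)) d = (c + 1) * (c' + 1) * (D d * E d) := by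
  refine (quadSum_eq e (c + 1) (c' + 1) (by linear_combination he) D E
    (fun n k => (donate n lam k : ℚ)) d (hDi 0 hi) hE ?_ d le_rfl).1
  intro n hn hnd
  obtain ⟨q, hq, hlt, heq⟩ := exists_last_block lam n hn
    fun a b h1 h2 h3 => hlam a b h1 h2 (h3.trans hnd)
  have hV : ∀ x : ℚ, x + 1 - ((lam n : ℚ) - q) = x - rowContent lam (q + 1) := fun x => by
    rw [rowContent, heq (q + 1) (Finset.mem_Ioc.2 ⟨by omega, by omega⟩)]
    push_cast; ring
  have hrow : ∀ k, q + 1 < k → k ≤ n → lam k = lam (k - 1) := fun k h1 h2 => by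
    rw [heq k (Finset.mem_Ioc.2 ⟨by omega, h2⟩), heq (k - 1) (Finset.mem_Ioc.2 ⟨by omega, by omega⟩)]
  have hErel : (i ≤ n ∨ 1 - e ^ 2 ≠ 0) →
      (c' - rowContent lam (q + 1)) * (E n - E q) = ((n : ℚ) - q) * E q := fun h => by
    have hiq : i ≤ q + 1 ∨ 1 - e ^ 2 ≠ 0 := by
      refine h.imp_left fun hin => ?_
      by_contra! hlt'
      have := hrow i hlt' hin
      omega
    exact block_relation E _ hq (hErec (q + 1) (by omega) (by omega) hiq)
      fun k h1 h2 => hEconst k (by omega) (by omega) (hrow k h1 h2)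
        (hiq.imp_left fun h => by omega)
  refine ⟨q, hq, (lam n : ℚ) - q, fun k hk => ?_, fun k hk => ?_, ?_, ?_, ?_⟩
  · rw [donate_of_le lam hq.le hk hlt heq]; push_cast; ring
  · rw [donate_last_block lam hk hlt heq]; push_cast; ring
  · rw [hV]
    exact block_relation D _ hq (hDrec (q + 1) (by omega) (by omega))
      fun k h1 h2 => hDconst k (by omega) (by omega) (hrow k h1 h2)
  · rw [hV]
    by_cases h : 1 - e ^ 2 = 0
    · rw [h]; ring
    · rw [hErel (Or.inr h)]
  · rw [hV]
    rcases lt_or_ge n i with h | h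
    · exact Or.inl ⟨hDi n h, hDi q (hq.trans h)⟩
    · exact Or.inr (hErel (Or.inl h))

theorem addBox_self (μ : ℕ → ℤ) (y : ℕ) : addBox μ y y = μ y + 1 := by simp [addBox]

theorem addBox_of_ne (μ : ℕ → ℤ) {x y : ℕ} (h : x ≠ y) : addBox μ y x = μ x := by
  simp [addBox, h]

theorem weylDim_congr {p : ℕ} {μ ν : ℕ → ℤ} (h : ∀ a, 1 ≤ a → a ≤ p → μ a = ν a) :
    weylDim p μ = weylDim p ν := by
  unfold weylDim
  refine Finset.prod_congr rfl fun a ha => Finset.prod_congr rfl fun b hb => ?_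
  simp only [Finset.mem_Icc] at ha hb
  rw [h a (by omega) (by omega), h b (by omega) (by omega)]

theorem weylDim_succ (p : ℕ) (μ : ℕ → ℤ) :
    weylDim (p + 1) μ = weylDim p μ * ∏ a ∈ Finset.Icc 1 p,
      (((μ a : ℚ) - (μ (p + 1) : ℚ)) + (((p + 1 : ℕ) : ℚ) - (a : ℚ)))
        / (((p + 1 : ℕ) : ℚ) - (a : ℚ)) := by
  unfold weylDim
  rw [Finset.prod_Icc_succ_top (by omega), Finset.Icc_eq_empty (a := p + 1 + 1) (by omega),
    Finset.prod_empty, mul_one, ← Finset.prod_mul_distrib]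
  refine Finset.prod_congr rfl fun a ha => ?_
  rw [Finset.prod_Icc_succ_top (by simp only [Finset.mem_Icc] at ha; omega)]

/-- The shifted coordinate `μ_a - a`. -/
def shifted (μ : ℕ → ℤ) (a : ℕ) : ℚ := (μ a : ℚ) - a

theorem weylDim_pos {p : ℕ} {μ : ℕ → ℤ}
    (h : ∀ a b, 1 ≤ a → a ≤ b → b ≤ p → μ b ≤ μ a) : 0 < weylDim p μ := by
  unfold weylDim
  refine Finset.prod_pos fun a ha => Finset.prod_pos fun b hb => ?_
  simp only [Finset.mem_Icc] at ha hb
  have h1 : (μ b : ℚ) ≤ μ a := by exact_mod_cast h a b (by omega) (by omega) (by omega)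
  have h2 : (a : ℚ) < b := by exact_mod_cast (by omega : a < b)
  apply div_pos <;> linarith

theorem shifted_lt {p : ℕ} {μ : ℕ → ℤ} (h : ∀ a b, 1 ≤ a → a ≤ b → b ≤ p → μ b ≤ μ a)
    {a b : ℕ} (h1 : 1 ≤ a) (h2 : a < b) (h3 : b ≤ p) : shifted μ b < shifted μ a := by
  have h4 : (μ b : ℚ) ≤ μ a := by exact_mod_cast h a b h1 h2.le h3
  have h5 : (a : ℚ) < b := by exact_mod_cast h2
  unfold shifted; linarith

theorem shifted_ne {p : ℕ} {μ : ℕ → ℤ} (h : ∀ a b, 1 ≤ a → a ≤ b → b ≤ p → μ b ≤ μ a)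
    {a b : ℕ} (ha : 1 ≤ a) (ha' : a ≤ p) (hb : 1 ≤ b) (hb' : b ≤ p) (hab : a ≠ b) :
    shifted μ a - shifted μ b ≠ 0 := by
  rcases lt_or_gt_of_ne hab with h1 | h1
  · exact (sub_pos.2 (shifted_lt h ha h1 hb')).ne'
  · exact (sub_neg.2 (shifted_lt h hb h1 ha')).ne

theorem weylDim_addBox_mul (μ : ℕ → ℤ) (k y : ℕ) (hy : 1 ≤ y) (hyk : y ≤ k) :
    weylDim k (addBox μ y) * ∏ a ∈ (Finset.Icc 1 k).erase y, (shifted μ y - shifted μ a)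
      = weylDim k μ * ∏ a ∈ (Finset.Icc 1 k).erase y, (shifted μ y - shifted μ a + 1) := by
  induction k, hyk using Nat.le_induction with
  | base =>
    obtain ⟨p, rfl⟩ : ∃ p, y = p + 1 := ⟨y - 1, by omega⟩
    have hIcc : (Finset.Icc 1 (p + 1)).erase (p + 1) = Finset.Icc 1 p := by
      ext; simp only [Finset.mem_erase, Finset.mem_Icc]; omega
    rw [weylDim_succ, weylDim_succ, hIcc, mul_assoc, mul_assoc, ← Finset.prod_mul_distrib,
      ← Finset.prod_mul_distrib]
    congr 1
    · refine weylDim_congr fun a _ h => ?_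
      rw [addBox_of_ne _ (by omega : a ≠ p + 1)]
    · refine Finset.prod_congr rfl fun a ha => ?_
      simp only [Finset.mem_Icc] at ha
      rw [addBox_of_ne _ (by omega : a ≠ p + 1), addBox_self, shifted, shifted]
      push_cast
      ring
  | succ k hk ih =>
    have hIcc : (Finset.Icc 1 (k + 1)).erase y = insert (k + 1) ((Finset.Icc 1 k).erase y) := by
      ext; simp only [Finset.mem_erase, Finset.mem_Icc, Finset.mem_insert]; omega
    have hnot : k + 1 ∉ (Finset.Icc 1 k).erase y := by simp
    have hmem : y ∈ Finset.Icc 1 k := Finset.mem_Icc.2 ⟨hy, hk⟩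
    rw [weylDim_succ, weylDim_succ, hIcc, Finset.prod_insert hnot, Finset.prod_insert hnot,
      ← Finset.mul_prod_erase _ _ hmem, ← Finset.mul_prod_erase _ _ hmem]
    have hrest : ∏ a ∈ (Finset.Icc 1 k).erase y,
          (((addBox μ y a : ℚ) - (addBox μ y (k + 1) : ℚ)) + (((k + 1 : ℕ) : ℚ) - (a : ℚ)))
            / (((k + 1 : ℕ) : ℚ) - (a : ℚ))
        = ∏ a ∈ (Finset.Icc 1 k).erase y,
          (((μ a : ℚ) - (μ (k + 1) : ℚ)) + (((k + 1 : ℕ) : ℚ) - (a : ℚ)))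
            / (((k + 1 : ℕ) : ℚ) - (a : ℚ)) := by
      refine Finset.prod_congr rfl fun a ha => ?_
      rw [addBox_of_ne _ (Finset.ne_of_mem_erase ha), addBox_of_ne _ (by omega : k + 1 ≠ y)]
    rw [hrest]
    generalize (∏ a ∈ (Finset.Icc 1 k).erase y, (shifted μ y - shifted μ a) : ℚ) = P at *
    generalize (∏ a ∈ (Finset.Icc 1 k).erase y, (shifted μ y - shifted μ a + 1) : ℚ) = Q at *
    generalize (∏ a ∈ (Finset.Icc 1 k).erase y, _ : ℚ) = R
    rw [addBox_self, addBox_of_ne _ (by omega : k + 1 ≠ y), shifted, shifted]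
    push_cast
    linear_combination ((μ y : ℚ) - y - ((μ (k + 1) : ℚ) - (k + 1))) * R
      * (((μ y : ℚ) + 1 - (μ (k + 1) : ℚ) + ((k : ℚ) + 1 - y)) / ((k : ℚ) + 1 - y)) * ih

theorem dimRatio_eq_prod {p : ℕ} {μ : ℕ → ℤ} (h : ∀ a b, 1 ≤ a → a ≤ b → b ≤ p → μ b ≤ μ a)
    {k y : ℕ} (hk : k ≤ p) (hy : 1 ≤ y) (hyk : y ≤ k) :
    dimRatio μ k y = ∏ a ∈ (Finset.Icc 1 k).erase y,
      (shifted μ y - shifted μ a + 1) / (shifted μ y - shifted μ a) := by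
  have h1 := weylDim_addBox_mul μ k y hy hyk
  have h2 : weylDim k μ ≠ 0 :=
    (weylDim_pos fun a b h1 h2 h3 => h a b h1 h2 (h3.trans hk)).ne'
  have h3 : ∏ a ∈ (Finset.Icc 1 k).erase y, (shifted μ y - shifted μ a) ≠ 0 := by
    refine Finset.prod_ne_zero_iff.2 fun a ha => ?_
    obtain ⟨ha1, ha2⟩ := Finset.mem_erase.1 ha
    rw [Finset.mem_Icc] at ha2
    exact shifted_ne h hy (by omega) ha2.1 (by omega) ha1.symm
  rw [dimRatio, if_pos hyk, Finset.prod_div_distrib, div_eq_div_iff h2 h3]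
  linear_combination h1

theorem dimRatio_of_lt (μ : ℕ → ℤ) {k y : ℕ} (h : k < y) : dimRatio μ k y = 0 :=
  if_neg (by omega)

theorem dimRatio_rec {p : ℕ} {μ : ℕ → ℤ} (h : ∀ a b, 1 ≤ a → a ≤ b → b ≤ p → μ b ≤ μ a)
    {k y : ℕ} (hk : k ≤ p) (hk1 : 1 ≤ k) (hy : 1 ≤ y) :
    (shifted μ y - shifted μ k) * (dimRatio μ k y - dimRatio μ (k - 1) y)
      = dimRatio μ (k - 1) y := by
  rcases lt_trichotomy k y with hky | rfl | hky
  · rw [dimRatio_of_lt μ hky, dimRatio_of_lt μ (by omega : k - 1 < y)]; ring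
  · rw [dimRatio_of_lt μ (by omega : k - 1 < k)]; ring
  · have hne := shifted_ne h hy (by omega) hk1 hk hky.ne
    have hIcc : (Finset.Icc 1 k).erase y = insert k ((Finset.Icc 1 (k - 1)).erase y) := by
      ext; simp only [Finset.mem_erase, Finset.mem_Icc, Finset.mem_insert]; omega
    rw [dimRatio_eq_prod h hk hy hky.le, dimRatio_eq_prod h (by omega) hy (by omega), hIcc,
      Finset.prod_insert (by simp only [Finset.mem_erase, Finset.mem_Icc]; omega)]
    field_simp
    ring

theorem dimRatio_eq_zero {p : ℕ} {μ : ℕ → ℤ} (h : ∀ a b, 1 ≤ a → a ≤ b → b ≤ p → μ b ≤ μ a)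
    {k y : ℕ} (hk : k ≤ p) (hy : 2 ≤ y) (heq : μ y = μ (y - 1)) : dimRatio μ k y = 0 := by
  by_cases hyk : y ≤ k
  · rw [dimRatio_eq_prod h hk (by omega) hyk]
    refine Finset.prod_eq_zero (i := y - 1) ?_ ?_
    · simp only [Finset.mem_erase, Finset.mem_Icc]; omega
    · rw [shifted, shifted, heq, Nat.cast_sub (by omega)]
      simp
  · simp [dimRatio, hyk]

theorem shifted_addBox (μ : ℕ → ℤ) (x a : ℕ) :
    shifted (addBox μ x) a = shifted μ a + if a = x then 1 else 0 := by
  simp only [shifted, addBox]; push_cast; ring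

theorem addBox_antitone {p : ℕ} {μ : ℕ → ℤ} (h : ∀ a b, 1 ≤ a → a ≤ b → b ≤ p → μ b ≤ μ a)
    {x : ℕ} (hx : x ≤ 1 ∨ μ x < μ (x - 1)) :
    ∀ a b, 1 ≤ a → a ≤ b → b ≤ p → addBox μ x b ≤ addBox μ x a := by
  intro a b h1 h2 h3
  have h4 := h a b h1 h2 h3
  simp only [addBox]
  split_ifs with hb ha
  · omega
  · subst hb
    have := h a (b - 1) h1 (by omega) (by omega)
    omega
  · omega
  · omega

/-- Comparison of the ratios into row `y` before and after a box is added to the row `x ≠ y`. -/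
theorem dimRatio_addBox {p : ℕ} {μ : ℕ → ℤ} (h : ∀ a b, 1 ≤ a → a ≤ b → b ≤ p → μ b ≤ μ a)
    {x y k : ℕ} (hx : x ≤ 1 ∨ μ x < μ (x - 1)) (hx1 : 1 ≤ x) (hy1 : 1 ≤ y) (hxy : x ≠ y)
    (hk : k ≤ p) (hxk : x ≤ k) (hyk : y ≤ k) :
    ((shifted μ y - shifted μ x) ^ 2 - 1) * dimRatio (addBox μ x) k y
      = (shifted μ y - shifted μ x) ^ 2 * dimRatio μ k y := by
  have h' := addBox_antitone h hx
  have hmem : x ∈ (Finset.Icc 1 k).erase y := by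
    simp only [Finset.mem_erase, Finset.mem_Icc]; omega
  have hne := shifted_ne h hy1 (by omega) hx1 (by omega) hxy.symm
  have hne' := shifted_ne h' hy1 (by omega) hx1 (by omega) hxy.symm
  rw [shifted_addBox, shifted_addBox, if_neg hxy.symm, if_pos rfl] at hne'
  rw [dimRatio_eq_prod h' hk hy1 hyk, dimRatio_eq_prod h hk hy1 hyk,
    ← Finset.mul_prod_erase _ _ hmem, ← Finset.mul_prod_erase _ _ hmem]
  have hrest : ∏ a ∈ ((Finset.Icc 1 k).erase y).erase x,
        (shifted (addBox μ x) y - shifted (addBox μ x) a + 1)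
          / (shifted (addBox μ x) y - shifted (addBox μ x) a)
      = ∏ a ∈ ((Finset.Icc 1 k).erase y).erase x,
        (shifted μ y - shifted μ a + 1) / (shifted μ y - shifted μ a) := by
    refine Finset.prod_congr rfl fun a ha => ?_
    rw [shifted_addBox, shifted_addBox, if_neg hxy.symm, if_neg (Finset.ne_of_mem_erase ha)]
    simp
  rw [hrest, shifted_addBox, shifted_addBox, if_neg hxy.symm, if_pos rfl]
  generalize (∏ a ∈ ((Finset.Icc 1 k).erase y).erase x, _ : ℚ) = R
  have hne'' : shifted μ y - shifted μ x - 1 ≠ 0 := by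
    intro h; apply hne'; linear_combination h
  have hden : shifted μ y + 0 - (shifted μ x + 1) = shifted μ y - shifted μ x - 1 := by ring
  rw [hden]
  field_simp
  ring

/-- The diagonal expression is a `quadSum` whenever `Fcoef` has the form `twoStep`. -/
theorem diagonal_sum_of_twoStep (d : ℕ) (lam : ℕ → ℕ) (i j : ℕ) (e : ℚ) (D E : ℕ → ℚ)
    (he : 1 / Del lam i j = e)
    (hF : ∀ s t, s ≤ d → t ≤ d → Fcoef lam i j s t = twoStep e D E s t) :
    ∑ k ∈ Finset.Icc 1 d, ∑ l ∈ Finset.Icc 1 d,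
        ((donate d lam k : ℚ) * (donate d lam l : ℚ)
            + 1 / Del lam i j * (donate d lam (max k l) : ℚ)) * gcoef lam i j k l
      = quadSum e D E (fun k => (donate d lam k : ℚ)) d := by
  have hIcc : Finset.Icc 1 d = Ioc 0 d := by ext; simp [Finset.mem_Icc, Nat.succ_le_iff]
  rw [quadSum, hIcc, he]
  refine Finset.sum_congr rfl fun k hk => Finset.sum_congr rfl fun l hl => ?_
  rw [Finset.mem_Ioc] at hk hl
  rw [gcoef, mixedDiff, hF _ _ (by omega) (by omega), hF _ _ (by omega) (by omega),
    hF _ _ (by omega) (by omega), hF _ _ (by omega) (by omega)]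

theorem shifted_intOf (lam : ℕ → ℕ) (k : ℕ) : shifted (intOf lam) k = rowContent lam k := by
  simp [shifted, intOf, rowContent]

theorem dimR2_eq {d : ℕ} {lam : ℕ → ℕ} {i j : ℕ} (hi : i ≤ d) (hj : j ≤ d)
    (h : ∀ a b, 1 ≤ a → a ≤ b → b ≤ d → addBox (intOf lam) i b ≤ addBox (intOf lam) i a) :
    dimR2 lam i j d = dimRatio (intOf lam) d i * dimRatio (addBox (intOf lam) i) d j := by
  have hne := (weylDim_pos h).ne'
  rw [dimR2, dimRatio, dimRatio, if_pos (max_le hi hj), if_pos hi, if_pos hj]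
  by_cases h0 : weylDim d (intOf lam) = 0
  · simp [h0]
  · field_simp

theorem diagonal_expression_debiased_keyl
    (d : ℕ) (hd : 1 ≤ d) (lam : ℕ → ℕ)
    (hlam : ∀ k, 1 ≤ k → k + 1 ≤ d → lam (k + 1) ≤ lam k)
    (i j : ℕ) (hi : i ∈ Finset.Icc 1 d) (hj : j ∈ Finset.Icc 1 d)
    (hvalid : i = 1 ∨ lam i < lam (i - 1)) :
    ∑ k ∈ Finset.Icc 1 d, ∑ l ∈ Finset.Icc 1 d,
        ((donate d lam k : ℚ) * (donate d lam l : ℚ)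
            + 1 / Del lam i j * (donate d lam (max k l) : ℚ)) * gcoef lam i j k l
      = (rowContent lam i + 1) * (rowContentAdd lam i j + 1) * dimR2 lam i j d := by
  obtain ⟨hi1, hid⟩ := Finset.mem_Icc.1 hi
  obtain ⟨hj1, hjd⟩ := Finset.mem_Icc.1 hj
  have hmono : ∀ a b, 1 ≤ a → a ≤ b → b ≤ d → lam b ≤ lam a := by
    intro a b h1 h2
    induction b, h2 using Nat.le_induction with
    | base => intro _; rfl
    | succ b hb ih => intro h3; exact (hlam b (by omega) h3).trans (ih (by omega))
  set μ := intOf lam with hμ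
  have hmonoμ : ∀ a b, 1 ≤ a → a ≤ b → b ≤ d → μ b ≤ μ a := fun a b h1 h2 h3 => by
    simpa [hμ, intOf] using hmono a b h1 h2 h3
  have hvalidμ : ∀ x, (x = 1 ∨ lam x < lam (x - 1)) → x ≤ 1 ∨ μ x < μ (x - 1) := fun x hx =>
    hx.imp (fun h => h.le) fun h => by simpa [hμ, intOf] using h
  have hmonoi := addBox_antitone hmonoμ (hvalidμ i hvalid)
  set D := fun k => dimRatio μ k i with hDdef
  set E' := fun k => dimRatio (addBox μ i) k j with hE'def
  have hX : ∀ k, shifted μ k = rowContent lam k := shifted_intOf lam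
  have hXlt : ∀ {a b}, 1 ≤ a → a < b → b ≤ d → rowContent lam b < rowContent lam a :=
    fun h1 h2 h3 => by
      rw [← hX, ← hX]; exact shifted_lt hmonoμ h1 h2 h3
  have hXne : ∀ {a b}, 1 ≤ a → a ≤ d → 1 ≤ b → b ≤ d → a ≠ b →
      rowContent lam a - rowContent lam b ≠ 0 := fun h1 h2 h3 h4 h5 => by
    rw [← hX, ← hX]; exact shifted_ne hmonoμ h1 h2 h3 h4 h5
  have hXpred : ∀ {k}, 2 ≤ k → lam k = lam (k - 1) →
      rowContent lam (k - 1) = rowContent lam k + 1 := fun {k} h1 h2 => by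
    rw [rowContent, rowContent, h2, Nat.cast_sub (by omega)]
    push_cast; ring
  have hDi : ∀ k < i, D k = 0 := fun k hk => dimRatio_of_lt _ hk
  have hDrec : ∀ k, 1 ≤ k → k ≤ d →
      (rowContent lam i - rowContent lam k) * (D k - D (k - 1)) = D (k - 1) := fun k h1 h2 => by
    rw [← hX, ← hX]; exact dimRatio_rec hmonoμ h2 h1 hi1
  have hDconst : ∀ k, 2 ≤ k → k ≤ d → lam k = lam (k - 1) →
      D k - D (k - 1) = D (k - 1) - D (k - 2) := fun k h1 h2 h3 =>
    const_diff_of_rec D (rowContent lam) _ k (hXpred h1 h3) (hDrec k (by omega) h2)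
      (hDrec (k - 1) (by omega) (by omega))
      (hXne hi1 hid (by omega) h2 (by rintro rfl; omega))
  have hE'rec : ∀ k, 1 ≤ k → k ≤ d → k ≠ i →
      (rowContentAdd lam i j - rowContent lam k) * (E' k - E' (k - 1)) = E' (k - 1) :=
    fun k h1 h2 h3 => by
      have := dimRatio_rec hmonoi h2 h1 hj1
      rw [shifted_addBox, shifted_addBox, if_neg h3, hX, hX] at this
      simp only [rowContentAdd, hE'def, eq_comm (a := i)]
      rw [rowContent] at this
      linear_combination this
  have hc' : rowContentAdd lam i j - rowContent lam i = Del lam i j := by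
    simp only [rowContentAdd, rowContent, Del]; ring
  have hR : rowContentAdd lam i j = rowContent lam j + if i = j then 1 else 0 := by
    simp only [rowContentAdd, rowContent]; ring
  have key : Del lam i j ≠ 0 → ∀ E : ℕ → ℚ, E d = E' d →
      (1 - (1 / Del lam i j) ^ 2) * E 0 = 0 →
      (∀ k, 1 ≤ k → k ≤ d → (i ≤ k ∨ 1 - (1 / Del lam i j) ^ 2 ≠ 0) →
        (rowContentAdd lam i j - rowContent lam k) * (E k - E (k - 1)) = E (k - 1)) →
      (∀ k, 2 ≤ k → k ≤ d → lam k = lam (k - 1) → (i < k ∨ 1 - (1 / Del lam i j) ^ 2 ≠ 0) →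
        E k - E (k - 1) = E (k - 1) - E (k - 2)) →
      (∀ s t, s ≤ d → t ≤ d → Fcoef lam i j s t = twoStep (1 / Del lam i j) D E s t) →
      ∑ k ∈ Finset.Icc 1 d, ∑ l ∈ Finset.Icc 1 d,
        ((donate d lam k : ℚ) * (donate d lam l : ℚ)
            + 1 / Del lam i j * (donate d lam (max k l) : ℚ)) * gcoef lam i j k l
      = (rowContent lam i + 1) * (rowContentAdd lam i j + 1) * dimR2 lam i j d := by
    intro hDel E hEd hE0 hErec hEconst hF
    rw [diagonal_sum_of_twoStep d lam i j _ D E rfl hF, dimR2_eq hid hjd hmonoi,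
      quadSum_donate _ _ _ (by rw [hc']; field_simp) D E lam d i hmono hi1 hvalid hDi hE0 hDrec
        hDconst hErec hEconst, hEd]
  rcases eq_or_ne i j with hij | hij
  · subst hij
    have hDel : Del lam i i = 1 := by simp [Del]
    have hcc : rowContentAdd lam i i = rowContent lam i + 1 := by linear_combination hc' + hDel
    set E : ℕ → ℚ := fun k => if i ≤ k then E' k else E' i / 2
    have hEge : ∀ {k}, i ≤ k → E k = E' k := fun h => if_pos h
    have hElt : ∀ {k}, k < i → E k = E' i / 2 := fun h => if_neg (by omega)
    have hErec : ∀ k, 1 ≤ k → k ≤ d → i ≤ k →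
        (rowContentAdd lam i i - rowContent lam k) * (E k - E (k - 1)) = E (k - 1) := by
      intro k h1 h2 h3
      rcases eq_or_lt_of_le h3 with rfl | h3
      · rw [hEge le_rfl, hElt (by omega), hcc]; ring
      · rw [hEge h3.le, hEge (by omega)]
        exact hE'rec k h1 h2 (by omega)
    refine key (by rw [hDel]; norm_num) E (hEge hid) (by rw [hDel]; ring) ?_ ?_ ?_
    · intro k h1 h2 h3
      exact hErec k h1 h2 (h3.resolve_right (by rw [hDel]; norm_num))
    · intro k h1 h2 h3 h4
      have h5 : i < k := h4.resolve_right (by rw [hDel]; norm_num)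
      refine const_diff_of_rec E (rowContent lam) _ k (hXpred h1 h3) (hErec k (by omega) h2 h5.le)
        (hErec (k - 1) (by omega) (by omega) (by omega)) ?_
      have := hXlt hi1 h5 h2
      rw [hcc]
      intro h0
      linarith
    · intro s t hs ht
      rw [Fcoef, hDel]
      unfold twoStep
      split_ifs with hst
      · rcases lt_or_ge s i with h | h
        · rw [dimRatio_of_lt _ h, hDi s h]; ring
        · rw [hEge (h.trans hst)]
      · rcases lt_or_ge t i with h | h
        · rw [dimRatio_of_lt _ h, hDi t h]; ring
        · rw [hEge (by omega : i ≤ s)]; ring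
  have hR' : rowContentAdd lam i j = rowContent lam j := by rw [hR, if_neg hij, add_zero]
  have hDelX : Del lam i j = rowContent lam j - rowContent lam i := by rw [← hc', hR']
  have hDel0 : Del lam i j ≠ 0 := by rw [hDelX]; exact hXne hj1 hjd hi1 hid hij.symm
  by_cases hadj : j = i + 1 ∧ lam i = lam j
  · obtain ⟨rfl, hlamij⟩ := hadj
    have hDel : Del lam i (i + 1) = -1 := by
      rw [hDelX, rowContent, rowContent, hlamij]; push_cast; ring
    have hEi : E' i = 0 := dimRatio_of_lt _ (by omega)
    set E : ℕ → ℚ := fun k => if i ≤ k then E' k else -E' (i + 1)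
    have hEge : ∀ {k}, i ≤ k → E k = E' k := fun h => if_pos h
    have hElt : ∀ {k}, k < i → E k = -E' (i + 1) := fun h => if_neg (by omega)
    have hErec : ∀ k, 1 ≤ k → k ≤ d → i ≤ k →
        (rowContentAdd lam i (i + 1) - rowContent lam k) * (E k - E (k - 1)) = E (k - 1) := by
      intro k h1 h2 h3
      rcases eq_or_lt_of_le h3 with rfl | h3
      · rw [hEge le_rfl, hElt (by omega), hc', hDel, hEi]; ring
      · rw [hEge h3.le, hEge (by omega)]
        exact hE'rec k h1 h2 (by omega)
    have hzero : ∀ t ≤ d, dimRatio μ t (i + 1) = 0 := fun t ht =>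
      dimRatio_eq_zero hmonoμ ht (by omega) (by simp [hμ, intOf, hlamij])
    refine key hDel0 E (hEge hid) (by rw [hDel]; ring) ?_ ?_ ?_
    · intro k h1 h2 h3
      exact hErec k h1 h2 (h3.resolve_right (by rw [hDel]; norm_num))
    · intro k h1 h2 h3 h4
      have h5 : i < k := h4.resolve_right (by rw [hDel]; norm_num)
      rcases eq_or_ne k (i + 1) with rfl | h6
      · rw [hEge (by omega), hEge (by omega), hElt (by omega)]
        simp [hEi]
      · exact const_diff_of_rec E (rowContent lam) _ k (hXpred h1 h3)
          (hErec k (by omega) h2 h5.le) (hErec (k - 1) (by omega) (by omega) (by omega))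
          (by rw [hR']; exact hXne hj1 hjd (by omega) h2 h6.symm)
    · intro s t hs ht
      rw [Fcoef, hDel, ← hμ, hzero t ht]
      unfold twoStep
      split_ifs with hst
      · rcases lt_or_ge s i with h | h
        · rw [dimRatio_of_lt _ h, hDi s h]; ring
        · rw [hEge (h.trans hst)]
      · rcases lt_or_ge t i with h | h
        · rw [dimRatio_of_lt _ h, hDi t h]; ring
        · rw [hEge (by omega : i ≤ s)]; ring
  · have hDelsq : Del lam i j ^ 2 - 1 ≠ 0 := by
      have h1 : Del lam i j = (((lam j : ℤ) - lam i + i - j : ℤ) : ℚ) := by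
        rw [hDelX, rowContent, rowContent]; push_cast; ring
      intro h2
      have h3 : ((lam j : ℤ) - lam i + i - j) ^ 2 = 1 := by
        have : (((lam j : ℤ) - lam i + i - j : ℤ) : ℚ) ^ 2 = 1 := by
          rw [← h1]; linear_combination h2
        exact_mod_cast this
      rcases lt_or_gt_of_ne hij with h | h
      · have := hmono i j hi1 h.le hjd
        rcases sq_eq_sq_iff_eq_or_eq_neg.1 (h3.trans (one_pow 2).symm) with h4 | h4 <;> omega
      · have h5 := hmono j i hj1 h.le hid
        have h6 := hmono j (i - 1) hj1 (by omega) (by omega)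
        rcases sq_eq_sq_iff_eq_or_eq_neg.1 (h3.trans (one_pow 2).symm) with h4 | h4 <;> omega
    set R := fun k => dimRatio μ k j with hRdef
    set κ := Del lam i j ^ 2 / (Del lam i j ^ 2 - 1) with hκ
    have hRrec : ∀ k, 1 ≤ k → k ≤ d →
        (rowContent lam j - rowContent lam k) * (R k - R (k - 1)) = R (k - 1) := fun k h1 h2 => by
      rw [← hX, ← hX]; exact dimRatio_rec hmonoμ h2 h1 hj1
    have hRzero : 2 ≤ j → lam j = lam (j - 1) → ∀ k ≤ d, R k = 0 := fun h1 h2 k hk =>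
      dimRatio_eq_zero hmonoμ hk h1 (by simp [hμ, intOf, h2])
    have hRconst : ∀ k, 2 ≤ k → k ≤ d → lam k = lam (k - 1) →
        R k - R (k - 1) = R (k - 1) - R (k - 2) := fun k h1 h2 h3 => by
      rcases eq_or_ne k j with rfl | h4
      · rw [hRzero h1 h3 k h2, hRzero h1 h3 _ (by omega), hRzero h1 h3 _ (by omega)]
      · exact const_diff_of_rec R (rowContent lam) _ k (hXpred h1 h3) (hRrec k (by omega) h2)
          (hRrec (k - 1) (by omega) (by omega)) (hXne hj1 hjd (by omega) h2 h4.symm)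
    have hE' : ∀ k, i ≤ k → k ≤ d → E' k = κ * R k := fun k h1 h2 => by
      rcases lt_or_ge k j with h3 | h3
      · simp only [hE'def, hRdef, dimRatio_of_lt _ h3, mul_zero]
      · have := dimRatio_addBox hmonoμ (hvalidμ i hvalid) hi1 hj1 hij h2 h1 h3
        rw [hX, hX, ← hDelX] at this
        rw [hκ, div_mul_eq_mul_div, eq_div_iff hDelsq]
        linear_combination this
    have hswap : ∀ s t, t ≤ s → s ≤ d → R t * dimRatio (addBox μ j) s i = κ * R t * D s := by
      intro s t hts hsd
      rcases lt_or_ge t j with h1 | h1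
      · simp only [hRdef, dimRatio_of_lt _ h1]; ring
      rcases lt_or_ge s i with h2 | h2
      · simp only [hDdef, dimRatio_of_lt _ h2]; ring
      by_cases h3 : j = 1 ∨ lam j < lam (j - 1)
      · have := dimRatio_addBox hmonoμ (hvalidμ j h3) hj1 hi1 hij.symm hsd (h1.trans hts) h2
        rw [hX, hX, ← neg_sub (rowContent lam j), neg_sq, ← hDelX] at this
        rw [hκ, mul_assoc, div_mul_eq_mul_div, eq_div_iff hDelsq]
        linear_combination R t * this
      · push Not at h3
        have h4 := hmono (j - 1) j (by omega) (by omega) hjd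
        rw [hRzero (by omega) (by omega) t (by omega)]; ring
    refine key hDel0 (fun k => κ * R k) (hE' d hid le_rfl).symm ?_ ?_ ?_ ?_
    · simp only [hRdef, dimRatio_of_lt _ (by omega : 0 < j)]; ring
    · intro k h1 h2 _
      rw [hR']
      linear_combination κ * hRrec k h1 h2
    · intro k h1 h2 h3 _
      linear_combination κ * hRconst k h1 h2 h3
    · intro s t hs ht
      rw [Fcoef, ← hμ]
      unfold twoStep
      split_ifs with hst
      · rcases lt_or_ge s i with h | h
        · rw [dimRatio_of_lt _ h, hDi s h]; ring
        · linear_combination D s * hE' t (h.trans hst) ht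
      · have h1 := hswap s t (by omega) hs
        have h2 : dimRatio μ t i * dimRatio (addBox μ i) s j = D t * (κ * R s) := by
          rcases lt_or_ge t i with h | h
          · rw [dimRatio_of_lt _ h, hDi t h]; ring
          · linear_combination D t * hE' s (by omega) hs
        rw [h2, h1]
        ring
end

section
/- Symmetry of two-step coefficients across the diagonal within a block: let λ be a Young diagram with at most d rows, let i, j ∈ [d], and let k ∈ [d−1] satisfy λ_k = λ_{k+1}. Then g(k, k+1) = g(k+1, k). -/
open Finset

theorem weylDim_eq_zero_of_factor {p : ℕ} {μ : ℕ → ℤ} {a b : ℕ} (ha : 1 ≤ a) (hab : a < b)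
    (hb : b ≤ p) (h : μ a - μ b + ((b : ℤ) - a) = 0) : weylDim p μ = 0 := by
  refine Finset.prod_eq_zero (Finset.mem_Icc.2 ⟨ha, by omega⟩)
    (Finset.prod_eq_zero (Finset.mem_Icc.2 ⟨hab, hb⟩) ?_)
  rw [div_eq_zero_iff]
  exact Or.inl (by exact_mod_cast h)

theorem exists_factor_of_weylDim_eq_zero {p : ℕ} {μ : ℕ → ℤ} (h : weylDim p μ = 0) :
    ∃ a b, 1 ≤ a ∧ a < b ∧ b ≤ p ∧ μ a - μ b + ((b : ℤ) - a) = 0 := by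
  obtain ⟨a, ha, h⟩ := Finset.prod_eq_zero_iff.1 h
  obtain ⟨b, hb, h⟩ := Finset.prod_eq_zero_iff.1 h
  rw [Finset.mem_Icc] at ha hb
  refine ⟨a, b, ha.1, hb.1, hb.2, ?_⟩
  rcases div_eq_zero_iff.1 h with h | h
  · exact_mod_cast h
  · have : (b : ℤ) - a = 0 := by exact_mod_cast h
    omega

theorem dimRatio_eq_zero_of_lt {μ : ℕ → ℤ} {p y : ℕ} (h : p < y) : dimRatio μ p y = 0 :=
  if_neg (by omega)

/-- Passing from `p` to `p + 1` rows multiplies the dimension ratio by `(x + 1) / x`, where `x` is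
the content difference of the rows `y` and `p + 1`. -/
theorem dimRatio_succ {p y : ℕ} {μ : ℕ → ℤ} (hy : 1 ≤ y) (hyp : y ≤ p)
    (hμ : ∀ b, 1 ≤ b → b ≤ p → μ b - μ (p + 1) + (((p + 1 : ℕ) : ℤ) - b) ≠ 0) {x : ℚ}
    (hx : (μ y : ℚ) - μ (p + 1) + (((p + 1 : ℕ) : ℚ) - y) = x) :
    dimRatio μ (p + 1) y = dimRatio μ p y * ((x + 1) / x) := by
  have hyI : y ∈ Finset.Icc 1 p := Finset.mem_Icc.2 ⟨hy, hyp⟩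
  rw [dimRatio, dimRatio, if_pos (by omega), if_pos hyp, weylDim_succ, weylDim_succ,
    mul_div_mul_comm, ← Finset.prod_div_distrib, Finset.prod_eq_single_of_mem y hyI]
  · have hne : y ≠ p + 1 := by omega
    have h0 : ((p + 1 : ℕ) : ℚ) - y ≠ 0 := sub_ne_zero.2 (by exact_mod_cast hne.symm)
    rw [div_div_div_cancel_right₀ h0, hx, ← hx]
    simp only [addBox, if_neg hne.symm, if_true]
    push_cast
    ring
  · intro b hb hby
    rw [Finset.mem_Icc] at hb
    have hne : p + 1 ≠ y := by omega
    simp only [addBox, if_neg hby, if_neg hne, add_zero]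
    refine div_self (div_ne_zero ?_ (sub_ne_zero.2 ?_))
    · exact_mod_cast hμ b hb.1 hb.2
    · have : p + 1 ≠ b := by omega
      exact_mod_cast this

theorem addBox_comm (μ : ℕ → ℤ) (i j : ℕ) :
    addBox (addBox μ i) j = addBox (addBox μ j) i := by
  funext x
  simp only [addBox]
  ring

/-- Adding a box to row `i` and then to row `j` is independent of the order at the level of
dimension ratios, unless the two boxes are adjacent. -/
theorem dimRatio_mul_comm {p : ℕ} {μ : ℕ → ℤ} (hμ : ∀ a b, 1 ≤ a → a < b → b ≤ p → μ b ≤ μ a)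
    {i j : ℕ} (hip : i ≤ p) (hjp : j ≤ p) (hij : i ≠ j)
    (hΔ : (μ j - μ i + ((i : ℤ) - j)) ^ 2 ≠ 1) :
    dimRatio μ p i * dimRatio (addBox μ i) p j = dimRatio μ p j * dimRatio (addBox μ j) p i := by
  have key : ∀ y z : ℕ, y ≠ z → (μ z - μ y + ((y : ℤ) - z)) ^ 2 ≠ 1 →
      weylDim p (addBox μ y) / weylDim p μ *
        (weylDim p (addBox (addBox μ y) z) / weylDim p (addBox μ y)) =
      weylDim p (addBox (addBox μ y) z) / weylDim p μ := by
    intro y z hyz hΔ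
    by_cases h0 : weylDim p (addBox μ y) = 0
    · obtain ⟨a, b, ha, hab, hb, h⟩ := exists_factor_of_weylDim_eq_zero h0
      have hle := hμ a b ha hab hb
      have hby : b = y := by
        by_contra hby
        simp only [addBox, if_neg hby] at h
        split_ifs at h <;> omega
      subst hby
      have hay : a ≠ b := by omega
      simp only [addBox, if_neg hay, if_true] at h
      have haz : a ≠ z := by
        rintro rfl
        apply hΔ
        have : μ a - μ b + ((b : ℤ) - a) = 1 := by linarith
        rw [this, one_pow]
      have : weylDim p (addBox (addBox μ b) z) = 0 := by
        refine weylDim_eq_zero_of_factor ha hab hb ?_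
        simp only [addBox, if_neg hay, if_neg haz, if_neg hyz, if_true]
        linarith
      simp [h0, this]
    · field_simp
  simp only [dimRatio, if_pos hip, if_pos hjp]
  rw [key i j hij hΔ, key j i hij.symm (by convert hΔ using 1; ring), addBox_comm]

/-- Corner sum of the products of dimension ratios for rows `m`, `m + 1`, `m + 2`, where rows
`m + 1` and `m + 2` have equal length: it does not depend on the order of the two boxes unless they
are adjacent. -/
theorem dimRatio_corner_sum_comm {m : ℕ} {μ : ℕ → ℤ}
    (hμ : ∀ a b, 1 ≤ a → a < b → b ≤ m + 2 → μ b ≤ μ a) (hblock : μ (m + 1) = μ (m + 2))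
    {i j : ℕ} (hi : 1 ≤ i) (hij : i < j) (hΔ : (μ j - μ i + ((i : ℤ) - j)) ^ 2 ≠ 1) :
    dimRatio μ (m + 1) j * dimRatio (addBox μ j) (m + 2) i
        - dimRatio μ m j * (dimRatio (addBox μ j) (m + 2) i - dimRatio (addBox μ j) (m + 1) i) =
      dimRatio μ (m + 1) i * dimRatio (addBox μ i) (m + 2) j
        - dimRatio μ m i *
          (dimRatio (addBox μ i) (m + 2) j - dimRatio (addBox μ i) (m + 1) j) := by
  have hbq : (μ (m + 1 + 1) : ℚ) = μ (m + 1) := by exact_mod_cast hblock.symm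
  have hμ1 : ∀ b, 1 ≤ b → b ≤ m → μ b - μ (m + 1) + (((m + 1 : ℕ) : ℤ) - b) ≠ 0 := by
    intro b h1 h2
    have := hμ b (m + 1) h1 (by omega) (by omega)
    omega
  have hy1 : ∀ y, y ≤ m → ∀ b, 1 ≤ b → b ≤ m →
      addBox μ y b - addBox μ y (m + 1) + (((m + 1 : ℕ) : ℤ) - b) ≠ 0 := by
    intro y hy b h1 h2
    have := hμ b (m + 1) h1 (by omega) (by omega)
    have hne : m + 1 ≠ y := by omega
    simp only [addBox, if_neg hne]
    split_ifs <;> omega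
  have hy2 : ∀ y, y ≤ m + 1 → ∀ b, 1 ≤ b → b ≤ m + 1 →
      addBox μ y b - addBox μ y (m + 1 + 1) + (((m + 1 + 1 : ℕ) : ℤ) - b) ≠ 0 := by
    intro y hy b h1 h2
    have : μ (m + 1 + 1) ≤ μ b := hμ b (m + 2) h1 (by omega) (by omega)
    have hne : m + 1 + 1 ≠ y := by omega
    simp only [addBox, if_neg hne]
    split_ifs <;> omega
  have hpos : ∀ y, 1 ≤ y → y ≤ m → (0 : ℚ) < μ y - μ (m + 1) + (((m + 1 : ℕ) : ℚ) - y) := by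
    intro y h1 h2
    have h := hμ y (m + 1) h1 (by omega) (by omega)
    have : (0 : ℤ) < μ y - μ (m + 1) + (((m + 1 : ℕ) : ℤ) - y) := by omega
    exact_mod_cast this
  have hstep1 : ∀ y, 1 ≤ y → y ≤ m → dimRatio μ (m + 1) y = dimRatio μ m y *
      (((μ y - μ (m + 1) + (((m + 1 : ℕ) : ℚ) - y)) + 1) /
        (μ y - μ (m + 1) + (((m + 1 : ℕ) : ℚ) - y))) :=
    fun y h1 h2 => dimRatio_succ h1 h2 hμ1 rfl
  have hstep1' : ∀ z, z ≤ m → ∀ y, 1 ≤ y → y ≤ m → y ≠ z →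
      dimRatio (addBox μ z) (m + 1) y = dimRatio (addBox μ z) m y *
      (((μ y - μ (m + 1) + (((m + 1 : ℕ) : ℚ) - y)) + 1) /
        (μ y - μ (m + 1) + (((m + 1 : ℕ) : ℚ) - y))) := by
    intro z hz y h1 h2 hyz
    refine dimRatio_succ h1 h2 (hy1 z hz) ?_
    have hne : m + 1 ≠ z := by omega
    simp [addBox, hyz, hne]
  have hstep2 : ∀ z, z ≤ m + 1 → ∀ y, 1 ≤ y → y ≤ m + 1 → y ≠ z →
      dimRatio (addBox μ z) (m + 2) y = dimRatio (addBox μ z) (m + 1) y *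
      (((μ y - μ (m + 1) + (((m + 1 : ℕ) : ℚ) - y)) + 2) /
        ((μ y - μ (m + 1) + (((m + 1 : ℕ) : ℚ) - y)) + 1)) := by
    intro z hz y h1 h2 hyz
    have hne : m + 1 + 1 ≠ z := by omega
    rw [dimRatio_succ (x := (μ y - μ (m + 1) + (((m + 1 : ℕ) : ℚ) - y)) + 1) h1 h2 (hy2 z hz)]
    · ring
    · simp only [addBox, if_neg hyz, if_neg hne, add_zero, hbq]
      push_cast
      ring
  rcases Nat.lt_or_ge (m + 1) j with hj | hj
  · rw [dimRatio_eq_zero_of_lt hj, dimRatio_eq_zero_of_lt (μ := μ) (p := m) (by omega),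
      dimRatio_eq_zero_of_lt hj]
    suffices h : (dimRatio μ (m + 1) i - dimRatio μ m i) *
        dimRatio (addBox μ i) (m + 2) j = 0 by linear_combination -h
    rcases Nat.lt_or_ge (m + 2) j with hj2 | hj2
    · rw [dimRatio_eq_zero_of_lt hj2, mul_zero]
    · obtain rfl : j = m + 2 := by omega
      have him : i ≠ m + 1 := by
        rintro rfl
        apply hΔ
        rw [hblock]
        push_cast
        ring
      have h0 : weylDim (m + 2) (addBox (addBox μ i) (m + 2)) = 0 := by
        refine weylDim_eq_zero_of_factor (a := m + 1) (b := m + 2) (by omega) (by omega) le_rfl ?_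
        have : m + 2 ≠ i := by omega
        simp only [addBox, if_neg him.symm, if_neg this, hblock]
        simp
      rw [dimRatio, dimRatio, dimRatio, if_pos le_rfl, h0, zero_div, mul_zero]
  rcases Nat.lt_or_ge m j with hjm | hjm
  · obtain rfl : j = m + 1 := by omega
    have hcomm := dimRatio_mul_comm (p := m + 1)
      (fun a b ha hab hb => hμ a b ha hab (by omega)) (by omega) hj hij.ne hΔ
    have hx := hpos i hi (by omega)
    rw [dimRatio_eq_zero_of_lt hjm, hstep2 (m + 1) le_rfl i hi (by omega) hij.ne,
      hstep2 i (by omega) (m + 1) (by omega) le_rfl hij.ne',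
      ← mul_assoc, ← hcomm, hstep1 i hi (by omega)]
    generalize (μ i : ℚ) - μ (m + 1) + (((m + 1 : ℕ) : ℚ) - i) = x at hx
    simp only [sub_self]
    field_simp
    ring
  · have hcomm := dimRatio_mul_comm (p := m)
      (fun a b ha hab hb => hμ a b ha hab (by omega)) (by omega) hjm hij.ne hΔ
    have hx := hpos i hi (by omega)
    have hy := hpos j (by omega) hjm
    rw [hstep2 j (by omega) i hi (by omega) hij.ne,
      hstep2 i (by omega) j (by omega) hj hij.ne',
      hstep1' j hjm i hi (by omega) hij.ne, hstep1' i (by omega) j (by omega) hjm hij.ne',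
      hstep1 i hi (by omega), hstep1 j (by omega) hjm]
    generalize (μ i : ℚ) - μ (m + 1) + (((m + 1 : ℕ) : ℚ) - i) = x at hx
    generalize (μ j : ℚ) - μ (m + 1) + (((m + 1 : ℕ) : ℚ) - j) = y at hy
    field_simp
    linear_combination (-(x * y + x + y + 2)) * hcomm

theorem two_step_symmetry_across_diagonal
    (d : ℕ) (hd : 1 ≤ d) (lam : ℕ → ℕ)
    (hlam : ∀ k, 1 ≤ k → k + 1 ≤ d → lam (k + 1) ≤ lam k)
    (i j : ℕ) (hi : i ∈ Finset.Icc 1 d) (hj : j ∈ Finset.Icc 1 d)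
    (k : ℕ) (hk1 : 1 ≤ k) (hk2 : k + 1 ≤ d) (hblock : lam k = lam (k + 1)) :
    gcoef lam i j k (k + 1) = gcoef lam i j (k + 1) k := by
  obtain ⟨m, rfl⟩ : ∃ m, k = m + 1 := ⟨k - 1, by omega⟩
  rw [Finset.mem_Icc] at hi hj
  have hanti : ∀ a b, 1 ≤ a → a < b → b ≤ m + 2 → intOf lam b ≤ intOf lam a := by
    intro a b ha hab
    induction b, hab using Nat.le_induction with
    | base => exact fun hb => Int.ofNat_le.2 (hlam a ha (by omega))
    | succ b hab ih =>
      exact fun hb => (Int.ofNat_le.2 (hlam b (by omega) (by omega))).trans (ih (by omega))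
  have hblock' : intOf lam (m + 1) = intOf lam (m + 2) := congrArg Nat.cast hblock
  have hdiv : Del lam i j ^ 2 = 1 ∨
      dimRatio (intOf lam) (m + 1) j * dimRatio (addBox (intOf lam) j) (m + 2) i
        - dimRatio (intOf lam) m j * (dimRatio (addBox (intOf lam) j) (m + 2) i
          - dimRatio (addBox (intOf lam) j) (m + 1) i) =
      dimRatio (intOf lam) (m + 1) i * dimRatio (addBox (intOf lam) i) (m + 2) j
        - dimRatio (intOf lam) m i * (dimRatio (addBox (intOf lam) i) (m + 2) j
          - dimRatio (addBox (intOf lam) i) (m + 1) j) := by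
    rcases eq_or_ne i j with rfl | hij
    · exact Or.inl (by simp [Del])
    refine or_iff_not_imp_left.2 fun hΔ => ?_
    have hΔ' : (intOf lam j - intOf lam i + ((i : ℤ) - j)) ^ 2 ≠ 1 := by
      intro h
      apply hΔ
      simp only [Del, if_neg hij, add_zero]
      simp only [intOf] at h
      exact_mod_cast h
    rcases lt_or_gt_of_ne hij with h | h
    · exact dimRatio_corner_sum_comm hanti hblock' hi.1 h hΔ'
    · exact (dimRatio_corner_sum_comm hanti hblock' hj.1 h
        (by convert hΔ' using 1; ring)).symm
  have h1 : ¬ m + 1 + 1 ≤ m + 1 := by omega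
  have h2 : ¬ m + 1 + 1 ≤ m := by omega
  have h3 : ¬ m + 1 ≤ m := by omega
  have h4 : m ≤ m + 1 + 1 := by omega
  simp only [gcoef, Fcoef, Nat.add_sub_cancel, if_neg h1, if_neg h2, if_neg h3, if_pos h4,
    if_pos (Nat.le_succ _), le_refl, if_true]
  rcases hdiv with h | h
  · rw [h]
    ring
  · linear_combination (1 / Del lam i j ^ 2 - 1) * h
end
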